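/- Let G=(V, E_p ∪ E_s ∪ E_t) be a positive instance of Hierarchical Partial Planarity, witnessed by a drawing Γ with no forbidden crossing. Then the drawing Γ_{p,s} induced by the edges in E_p ∪ E_s is planar, and the planar embedding 𝒢' of the graph G'=(V, E_p ∪ E_s) corresponding to Γ_{p,s} has the property that, for every tertiary edge (u,v) ∈ E_t, the vertices u and v are incident to a common face of the restriction ℋ' of 𝒢' to the subgraph H' induced by E_p. Hence the instance ⟨G', W⟩ of Facial-Constrained Core Planarity with E_1 = E_p, E_2 = E_s, and W = {⟨u,v⟩ : (u,v) ∈ E_t} is positive. -/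

import Mathlib

open Set

noncomputable section

/-- Points of the plane. -/
abbrev Pt : Type := ℝ × ℝ

/-- An edge set on the vertex type `V`: a set of ordered pairs of vertices. -/
abbrev EdgeSet (V : Type) := Set (V × V)

/-- The vertices incident to at least one edge of `F` (the vertex set of the
subgraph induced by `F`, isolated vertices being dropped). -/
def vertexSupport {V : Type} (F : EdgeSet V) : Set V :=
  {v | ∃ e ∈ F, v = e.1 ∨ v = e.2}

/-- A drawing of the graph `(V, E)` in the plane: vertices are mapped to distinct
points, and every edge `e ∈ E` is drawn as a simple (Jordan) arc joining the
points of its two endpoints whose interior passes through no vertex point. -/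
structure Drawing (V : Type) (E : EdgeSet V) where
  pos : V → Pt
  pos_inj : Function.Injective pos
  curve : V × V → ℝ → Pt
  curve_contOn : ∀ e ∈ E, ContinuousOn (curve e) (Set.Icc (0:ℝ) 1)
  curve_injOn : ∀ e ∈ E, Set.InjOn (curve e) (Set.Icc (0:ℝ) 1)
  curve_src : ∀ e ∈ E, curve e 0 = pos e.1
  curve_tgt : ∀ e ∈ E, curve e 1 = pos e.2
  curve_avoids : ∀ e ∈ E, ∀ v : V, pos v ∉ curve e '' Set.Ioo (0:ℝ) 1

namespace Drawing

variable {V : Type} {E : EdgeSet V}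

/-- The open arc drawn for an edge (excluding its endpoints). -/
def openArc (D : Drawing V E) (e : V × V) : Set Pt := D.curve e '' Set.Ioo (0:ℝ) 1

/-- The set of points of the plane covered by the drawing of the edges of `F`
(arcs together with their endpoints). -/
def image (D : Drawing V E) (F : EdgeSet V) : Set Pt :=
  ⋃ e ∈ F, D.curve e '' Set.Icc (0:ℝ) 1

/-- The set of points covered by the interiors of the arcs of the edges of `F`. -/
def openImage (D : Drawing V E) (F : EdgeSet V) : Set Pt :=
  ⋃ e ∈ F, D.openArc e

/-- Two distinct edges cross if the interiors of their arcs share a point. -/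
def Crosses (D : Drawing V E) (e e' : V × V) : Prop :=
  e ≠ e' ∧ (D.openArc e ∩ D.openArc e').Nonempty

/-- No two edges of `F` cross each other in the drawing. -/
def PlanarOn (D : Drawing V E) (F : EdgeSet V) : Prop :=
  ∀ e ∈ F, ∀ e' ∈ F, ¬ D.Crosses e e'

/-- A planar drawing: no two edges cross. -/
def Planar (D : Drawing V E) : Prop := D.PlanarOn E

/-- `f` is a face of the sub-drawing induced by the edges of `F`: a connected
component of the complement of the drawn image of `F`. -/
def IsFaceOf (D : Drawing V E) (F : EdgeSet V) (f : Set Pt) : Prop :=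
  ∃ p ∈ (D.image F)ᶜ, f = connectedComponentIn (D.image F)ᶜ p

/-- The outer face: the unbounded face. -/
def IsOuterFaceOf (D : Drawing V E) (F : EdgeSet V) (f : Set Pt) : Prop :=
  D.IsFaceOf F f ∧ ¬ Bornology.IsBounded f

/-- A vertex is incident to (lies on) a face if its point belongs to the
closure of the face. -/
def VertexOn (D : Drawing V E) (f : Set Pt) (v : V) : Prop :=
  D.pos v ∈ closure f

/-- The drawing of the edges of `F` is contained in, or incident to, the
face `f`: the closure of `f` meets the interior of some arc of `F`. -/
def TouchesFace (D : Drawing V E) (F : EdgeSet V) (f : Set Pt) : Prop :=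
  (closure f ∩ D.openImage F).Nonempty

/-- The restriction of a drawing to a smaller edge set (the drawing of a
subgraph). -/
def restrict (D : Drawing V E) (F : EdgeSet V) (h : F ⊆ E) : Drawing V F where
  pos := D.pos
  pos_inj := D.pos_inj
  curve := D.curve
  curve_contOn := fun e he => D.curve_contOn e (h he)
  curve_injOn := fun e he => D.curve_injOn e (h he)
  curve_src := fun e he => D.curve_src e (h he)
  curve_tgt := fun e he => D.curve_tgt e (h he)
  curve_avoids := fun e he => D.curve_avoids e (h he)

end Drawing

/-- A crossing between edges `e` and `e'` is *forbidden* if it involves a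
primary edge or two secondary edges. -/
def ForbiddenPair {V : Type} (Ep Es : EdgeSet V) (e e' : V × V) : Prop :=
  e ∈ Ep ∨ e' ∈ Ep ∨ (e ∈ Es ∧ e' ∈ Es)

/-- The drawing `D` of `G = (V, Ep ∪ Es ∪ Et)` has no forbidden crossing:
primary edges are crossing-free and secondary edges may only cross tertiary
edges. -/
def NoForbiddenCrossing {V : Type} (Ep Es Et : EdgeSet V)
    (D : Drawing V (Ep ∪ Es ∪ Et)) : Prop :=
  ∀ e ∈ Ep ∪ Es ∪ Et, ∀ e' ∈ Ep ∪ Es ∪ Et,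
    D.Crosses e e' → ¬ ForbiddenPair Ep Es e e'

/-- Hierarchical Partial Planarity: the graph `(V, Ep ∪ Es ∪ Et)` admits a
drawing with no forbidden crossing. -/
def HPPPositive (V : Type) (Ep Es Et : EdgeSet V) : Prop :=
  ∃ D : Drawing V (Ep ∪ Es ∪ Et), NoForbiddenCrossing Ep Es Et D

/-- A solution of the Facial-Constrained Core Planarity instance
`⟨G = (V, E1 ∪ E2), W⟩`: a planar drawing of `G` such that for every pair
`⟨u,v⟩ ∈ W` some face of the restriction to the core (the subgraph induced
by `E1`) contains both `u` and `v`. -/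
def FCCPSolution {V : Type} (E1 E2 : EdgeSet V) (W : Set (V × V))
    (D : Drawing V (E1 ∪ E2)) : Prop :=
  D.Planar ∧ ∀ p ∈ W, ∃ f, D.IsFaceOf E1 f ∧ D.VertexOn f p.1 ∧ D.VertexOn f p.2

/-- Facial-Constrained Core Planarity. -/
def FCCPPositive (V : Type) (E1 E2 : EdgeSet V) (W : Set (V × V)) : Prop :=
  ∃ D : Drawing V (E1 ∪ E2), FCCPSolution E1 E2 W D

/-- The simple graph induced by an edge set. -/
def graphOf {V : Type} (F : EdgeSet V) : SimpleGraph V :=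
  SimpleGraph.fromRel (fun a b => (a, b) ∈ F)

/-- The graph induced by the edge set `F` is biconnected: removing any single
vertex leaves it connected. -/
def Biconnected {V : Type} (F : EdgeSet V) : Prop :=
  ∀ x : V, ((graphOf F).induce {v | v ∈ vertexSupport F ∧ v ≠ x}).Connected

/-- A simple path from `u` to `v` all of whose edges belong to `F`. -/
structure CorePath {V : Type} (F : EdgeSet V) (u v : V) where
  len : ℕ
  vtx : Fin (len + 1) → V
  vtx_inj : Function.Injective vtx
  src : vtx 0 = u
  tgt : vtx (Fin.last len) = v
  edge_mem : ∀ i : Fin len,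
    (vtx i.castSucc, vtx i.succ) ∈ F ∨ (vtx i.succ, vtx i.castSucc) ∈ F

/-- A simple cycle through `u` and `v` all of whose edges belong to `F`. -/
structure CoreCycle {V : Type} (F : EdgeSet V) (u v : V) where
  len : ℕ
  len_ge : 3 ≤ len
  vtx : ZMod len → V
  vtx_inj : Function.Injective vtx
  mem_u : u ∈ Set.range vtx
  mem_v : v ∈ Set.range vtx
  edge_mem : ∀ i : ZMod len, (vtx i, vtx (i + 1)) ∈ F ∨ (vtx (i + 1), vtx i) ∈ F

/-- The set of edges used by a cycle. -/
def CoreCycle.edgeSet {V : Type} {F : EdgeSet V} {u v : V}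
    (C : CoreCycle F u v) : EdgeSet V :=
  {p | p ∈ F ∧ ∃ i : ZMod C.len,
    p = (C.vtx i, C.vtx (i + 1)) ∨ p = (C.vtx (i + 1), C.vtx i)}

/-- The four kinds of nodes of an SPQR-tree. -/
inductive SPQRType : Type
  | S | P | Q | R
deriving DecidableEq

/-- An (abstract) SPQR-tree of the biconnected graph `(V, E)`: the tree of its
triconnected components.  Every node has two poles (the endvertices of its
reference edge), a pertinent graph (a subgraph of `G` given by its edge set),
a type, and a set of children. -/
structure SPQRTree (V : Type) (E : EdgeSet V) where
  Node : Type
  root : Node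
  pert : Node → EdgeSet V
  pole1 : Node → V
  pole2 : Node → V
  poles_ne : ∀ μ, pole1 μ ≠ pole2 μ
  pert_sub : ∀ μ, pert μ ⊆ E
  pert_root : pert root = E
  nodeType : Node → SPQRType
  children : Node → Set Node
  child_pert_sub : ∀ {μ ν}, ν ∈ children μ → pert ν ⊆ pert μ
  child_pert_disj : ∀ {μ ν ν'}, ν ∈ children μ → ν' ∈ children μ → ν ≠ ν' →
    Disjoint (pert ν) (pert ν')
  pert_union : ∀ μ, nodeType μ ≠ SPQRType.Q → pert μ = ⋃ ν ∈ children μ, pert ν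
  /-- the pertinent graph meets the rest of the graph only at the poles -/
  sep_poles : ∀ μ,
    vertexSupport (pert μ) ∩ vertexSupport (E \ pert μ) ⊆ {pole1 μ, pole2 μ}
  /-- the skeleton of an S-node is a simple cycle: its children are arranged
  in a path between the two poles -/
  snode_cycle : ∀ μ, nodeType μ = SPQRType.S →
    ∃ (h : ℕ) (w : Fin (h + 1) → V) (cs : Fin h → Node),
      2 ≤ h ∧ Function.Injective w ∧ w 0 = pole1 μ ∧ w (Fin.last h) = pole2 μ ∧
      Function.Injective cs ∧ children μ = Set.range cs ∧
      ∀ i : Fin h, ({pole1 (cs i), pole2 (cs i)} : Set V) = {w i.castSucc, w i.succ}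
  /-- the skeleton of a P-node is a bundle of parallel edges: all children
  share the poles of the node, and there are at least two of them -/
  pnode_poles : ∀ μ, nodeType μ = SPQRType.P →
    (∀ ν ∈ children μ, ({pole1 ν, pole2 ν} : Set V) = ({pole1 μ, pole2 μ} : Set V)) ∧
    ∃ ν ν', ν ∈ children μ ∧ ν' ∈ children μ ∧ ν ≠ ν'

/-- A node `μ` is non-traversable (w.r.t. the core edge set `E1`) if there is a
cycle composed of edges of `E1` containing both poles of `μ`, at least one
edge of `pert μ`, and at least one edge of `G \ pert μ`. -/
def NodeNonTraversable {V : Type} {E : EdgeSet V} (E1 : EdgeSet V)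
    (T : SPQRTree V E) (μ : T.Node) : Prop :=
  ∃ C : CoreCycle E1 (T.pole1 μ) (T.pole2 μ),
    (C.edgeSet ∩ T.pert μ).Nonempty ∧ (C.edgeSet \ T.pert μ).Nonempty

/-- A node is traversable if it is not non-traversable. -/
def NodeTraversable {V : Type} {E : EdgeSet V} (E1 : EdgeSet V)
    (T : SPQRTree V E) (μ : T.Node) : Prop :=
  ¬ NodeNonTraversable E1 T μ

/-- The edges of `G` represented by the graph `H^skel_μ`: the core edges in the
pertinent graphs of the non-traversable children of `μ`, together with (when
`μ` itself is non-traversable) the core edges of `G \ pert μ` (represented by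
the reference edge of `μ`). -/
def HskelEdges {V : Type} {E : EdgeSet V} (E1 : EdgeSet V)
    (T : SPQRTree V E) (μ : T.Node) : EdgeSet V :=
  {e | e ∈ E1 ∧ ((∃ ν ∈ T.children μ, NodeNonTraversable E1 T ν ∧ e ∈ T.pert ν) ∨
      (NodeNonTraversable E1 T μ ∧ e ∈ E ∧ e ∉ T.pert μ))}

/-- `C` is the component represented by the virtual edge `e^y` of `skel μ`
containing the vertex `y`: either the pertinent graph of a child `ν_j ≠ ν_i`
of `μ`, or the rest of the graph `G \ pert μ` (represented by `ref μ`). -/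
def CompOfSpec {V : Type} {E : EdgeSet V} (T : SPQRTree V E) (μ νi : T.Node)
    (y : V) (C : EdgeSet V) : Prop :=
  (∃ νj ∈ T.children μ, νj ≠ νi ∧ y ∈ vertexSupport (T.pert νj) ∧ C = T.pert νj) ∨
  (y ∉ vertexSupport (T.pert μ) ∧ C = E \ T.pert μ)

/-- `c` is one of the components of `G` represented by the virtual edges of
`H^skel_μ`. -/
def IsVirtualComp {V : Type} {E : EdgeSet V} (E1 : EdgeSet V)
    (T : SPQRTree V E) (μ : T.Node) (c : EdgeSet V) : Prop :=
  (∃ ν ∈ T.children μ, NodeNonTraversable E1 T ν ∧ c = T.pert ν) ∨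
  (NodeNonTraversable E1 T μ ∧ c = E \ T.pert μ)

/-- The vertex set of the component of `G` corresponding to a vertex of the
auxiliary graph `G_aux` of a P-node `μ`: `some ν` stands for a child `ν` of
`μ` and `none` stands for `ref μ`, i.e. `G \ pert μ`. -/
def compVerts {V : Type} {E : EdgeSet V} (T : SPQRTree V E) (μ : T.Node) :
    Option T.Node → Set V
  | some ν => vertexSupport (T.pert ν)
  | none => vertexSupport (E \ T.pert μ)

/-- A black vertex of `G_aux`: a non-traversable child, or `ref μ` when `μ` is
non-traversable. -/
def IsBlackComp {V : Type} {E : EdgeSet V} (E1 : EdgeSet V) (T : SPQRTree V E)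
    (μ : T.Node) : Option T.Node → Prop
  | some ν => ν ∈ T.children μ ∧ NodeNonTraversable E1 T ν
  | none => NodeNonTraversable E1 T μ

/-- A white vertex of `G_aux`: a traversable child, or `ref μ` when `μ` is
traversable. -/
def IsWhiteComp {V : Type} {E : EdgeSet V} (E1 : EdgeSet V) (T : SPQRTree V E)
    (μ : T.Node) : Option T.Node → Prop
  | some ν => ν ∈ T.children μ ∧ NodeTraversable E1 T ν
  | none => NodeTraversable E1 T μ

/-- Two vertices of `G_aux` are linked if some pair of `W` has one member in
each of the two corresponding components. -/
def linked {V : Type} {E : EdgeSet V} (T : SPQRTree V E) (μ : T.Node)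
    (W : Set (V × V)) (c c' : Option T.Node) : Prop :=
  ∃ p ∈ W, (p.1 ∈ compVerts T μ c ∧ p.2 ∈ compVerts T μ c') ∨
           (p.1 ∈ compVerts T μ c' ∧ p.2 ∈ compVerts T μ c)

/-- Two white vertices belong to the same contracted white cluster of `G_aux`. -/
def whiteConn {V : Type} {E : EdgeSet V} (E1 : EdgeSet V) (T : SPQRTree V E)
    (μ : T.Node) (W : Set (V × V)) : Option T.Node → Option T.Node → Prop :=
  Relation.ReflTransGen
    (fun a b => IsWhiteComp E1 T μ a ∧ IsWhiteComp E1 T μ b ∧ linked T μ W a b)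

/-- Adjacency between black vertices in the reduced auxiliary graph
`Ḡ_aux`: a direct link, or a link through a (contracted) chain of
degree-two white vertices. -/
def blackAdjRel {V : Type} {E : EdgeSet V} (E1 : EdgeSet V) (T : SPQRTree V E)
    (μ : T.Node) (W : Set (V × V)) (b b' : Option T.Node) : Prop :=
  IsBlackComp E1 T μ b ∧ IsBlackComp E1 T μ b' ∧ b ≠ b' ∧
    (linked T μ W b b' ∨
      ∃ w w', IsWhiteComp E1 T μ w ∧ IsWhiteComp E1 T μ w' ∧
        linked T μ W b w ∧ whiteConn E1 T μ W w w' ∧ linked T μ W w' b')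

/-- The reduced auxiliary graph `Ḡ_aux` on the black vertices. -/
def auxGraph {V : Type} {E : EdgeSet V} (E1 : EdgeSet V) (T : SPQRTree V E)
    (μ : T.Node) (W : Set (V × V)) :
    SimpleGraph {c : Option T.Node // IsBlackComp E1 T μ c} :=
  SimpleGraph.fromRel (fun a b => blackAdjRel E1 T μ W a.1 b.1)

/-- A graph is either a single cycle through all its vertices or a
vertex-disjoint collection of paths (possibly single vertices): every vertex
has degree at most two, and the graph is acyclic or connected and 2-regular. -/
def IsCycleOrPaths {α : Type} (G : SimpleGraph α) : Prop :=
  (∀ v a b c : α, G.Adj v a → G.Adj v b → G.Adj v c → a = b ∨ a = c ∨ b = c) ∧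
  (G.IsAcyclic ∨ (G.Connected ∧ ∀ v : α, ∃ a b, a ≠ b ∧ G.Adj v a ∧ G.Adj v b))

/-- The bags of a node: a special bag together with a family of bags each
consisting of two pockets. -/
structure Bags (V : Type) where
  special : Set V
  ι : Type
  pocketS : ι → Set V
  pocketT : ι → Set V

/-- Requirement R.1 for a drawing of `pert μ` (with edge set `F`): every pair
of `W` whose two members belong to `pert μ` shares a face of the restriction
to the core. -/
def SatisfiesR1 {V : Type} {F : EdgeSet V} (E1 : EdgeSet V) (W : Set (V × V))
    (D : Drawing V F) : Prop :=
  ∀ p ∈ W, p.1 ∈ vertexSupport F → p.2 ∈ vertexSupport F →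
    ∃ f, D.IsFaceOf (E1 ∩ F) f ∧ D.VertexOn f p.1 ∧ D.VertexOn f p.2

/-- Requirement R.2 for a drawing of `pert μ` (with edge set `F`): for every
pair of `W` with exactly one member in `pert μ`, that member lies on the outer
face of the restriction to the core. -/
def SatisfiesR2 {V : Type} {F : EdgeSet V} (E1 : EdgeSet V) (W : Set (V × V))
    (D : Drawing V F) : Prop :=
  ∀ p ∈ W, p.1 ∈ vertexSupport F → p.2 ∉ vertexSupport F →
    ∃ f, D.IsOuterFaceOf (E1 ∩ F) f ∧ D.VertexOn f p.1

/-- A drawing of `pert μ` is described by the bags `B`: there are two faces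
`f_l`, `f_r` of the restriction to the core such that every vertex of the
special bag is incident to both, and for every bag its two pockets are
incident to `f_l` and `f_r` respectively, up to a flip. -/
def DescribedBy {V : Type} {F : EdgeSet V} (E1 : EdgeSet V) (D : Drawing V F)
    (B : Bags V) : Prop :=
  ∃ fl fr, D.IsFaceOf (E1 ∩ F) fl ∧ D.IsFaceOf (E1 ∩ F) fr ∧
    (∀ v ∈ B.special, D.VertexOn fl v ∧ D.VertexOn fr v) ∧
    ∀ i : B.ι,
      ((∀ v ∈ B.pocketS i, D.VertexOn fl v) ∧ (∀ v ∈ B.pocketT i, D.VertexOn fr v)) ∨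
      ((∀ v ∈ B.pocketS i, D.VertexOn fr v) ∧ (∀ v ∈ B.pocketT i, D.VertexOn fl v))

/-- Partial Planarity: `G = (V, E)` has a drawing in which no edge of `F` is
crossed. -/
def PPPositive (V : Type) (E F : EdgeSet V) : Prop :=
  ∃ D : Drawing V E, ∀ e ∈ F, ∀ e' ∈ E, ¬ D.Crosses e e'

/-- Partially-Embedded Planarity: the given planar drawing `DH` of the
subgraph with edge set `EH` extends to a planar drawing of the whole graph. -/
def PEPPositive {V : Type} (E EH : EdgeSet V) (DH : Drawing V EH) : Prop :=
  ∃ D : Drawing V E, D.Planar ∧ D.pos = DH.pos ∧ ∀ e ∈ EH, D.curve e = DH.curve e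

/-- The vertices of `S` appear in the same cyclic order along the boundaries of
`f` (w.r.t. the vertex placement `p`) and of `f'` (w.r.t. `q`): the two
boundaries can be parametrized by the circle so that each vertex of `S` is met
at the same parameter. -/
def SameFacialOrder {V : Type} (p q : V → Pt) (S : Set V) (f f' : Set Pt) : Prop :=
  ∃ γ γ' : AddCircle (1 : ℝ) → Pt,
    Continuous γ ∧ Continuous γ' ∧ Function.Injective γ ∧ Function.Injective γ' ∧
    Set.range γ = frontier f ∧ Set.range γ' = frontier f' ∧
    ∀ v ∈ S, ∃ t, γ t = p v ∧ γ' t = q v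

end


namespace Drawing

variable {V : Type} {E : EdgeSet V}

/-- A drawn arc consists of its interior and its two endpoints, which are vertex points. -/
theorem mem_openArc_or_eq_pos (D : Drawing V E) {e : V × V} (he : e ∈ E) {p : Pt}
    (hp : p ∈ D.curve e '' Set.Icc (0:ℝ) 1) : p ∈ D.openArc e ∨ ∃ v, p = D.pos v := by
  obtain ⟨t, ht, rfl⟩ := hp
  rcases ht.1.eq_or_lt with rfl | h0
  · exact Or.inr ⟨e.1, D.curve_src e he⟩
  rcases ht.2.eq_or_lt with rfl | h1
  · exact Or.inr ⟨e.2, D.curve_tgt e he⟩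
  · exact Or.inl ⟨t, ⟨h0, h1⟩, rfl⟩

/-- An open arc crossing no edge of `F` avoids the drawing of `F`. -/
theorem openArc_subset_compl_image (D : Drawing V E) {F : EdgeSet V} (hF : F ⊆ E)
    {e : V × V} (he : e ∈ E) (heF : e ∉ F) (hc : ∀ e' ∈ F, ¬ D.Crosses e e') :
    D.openArc e ⊆ (D.image F)ᶜ := by
  intro p hp hpF
  obtain ⟨e', he', hpe'⟩ := Set.mem_iUnion₂.1 hpF
  rcases D.mem_openArc_or_eq_pos (hF he') hpe' with h | ⟨v, rfl⟩
  · exact hc e' he' ⟨fun h' => heF (h' ▸ he'), p, hp, h⟩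
  · exact D.curve_avoids e he v hp

theorem isPreconnected_openArc (D : Drawing V E) {e : V × V} (he : e ∈ E) :
    IsPreconnected (D.openArc e) :=
  isPreconnected_Ioo.image _ ((D.curve_contOn e he).mono Set.Ioo_subset_Icc_self)

theorem curve_mem_closure_openArc (D : Drawing V E) {e : V × V} (he : e ∈ E) {t : ℝ}
    (ht : t ∈ Set.Icc (0:ℝ) 1) : D.curve e t ∈ closure (D.openArc e) := by
  have hcl : t ∈ closure (Set.Ioo (0:ℝ) 1) := by
    rwa [closure_Ioo zero_ne_one]
  exact ((D.curve_contOn e he t ht).mono Set.Ioo_subset_Icc_self).mem_closure_image hcl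

/-- The endpoints of an edge not in `F` and crossing no edge of `F` share a face of the
sub-drawing of `F`. -/
theorem exists_common_face (D : Drawing V E) {F : EdgeSet V} (hF : F ⊆ E)
    {e : V × V} (he : e ∈ E) (heF : e ∉ F) (hc : ∀ e' ∈ F, ¬ D.Crosses e e') :
    ∃ f, D.IsFaceOf F f ∧ D.VertexOn f e.1 ∧ D.VertexOn f e.2 := by
  have hsub := D.openArc_subset_compl_image hF he heF hc
  have hmid : D.curve e (1 / 2) ∈ D.openArc e := ⟨1 / 2, by norm_num, rfl⟩
  have hface := (D.isPreconnected_openArc he).subset_connectedComponentIn hmid hsub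
  refine ⟨_, ⟨_, hsub hmid, rfl⟩, closure_mono hface ?_, closure_mono hface ?_⟩
  · rw [← D.curve_src e he]
    exact D.curve_mem_closure_openArc he (by norm_num)
  · rw [← D.curve_tgt e he]
    exact D.curve_mem_closure_openArc he (by norm_num)

end Drawing

/-- If `G = (V, E_p ∪ E_s ∪ E_t)` is a positive instance of
Hierarchical Partial Planarity witnessed by a drawing `Γ` with no forbidden
crossing, then the sub-drawing `Γ_{p,s}` induced by the edges of
`E_p ∪ E_s` is planar, for every tertiary edge `(u,v) ∈ E_t` the vertices
`u` and `v` lie on a common face of the restriction of `Γ_{p,s}` to the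
subgraph induced by `E_p`, and hence the derived Facial-Constrained Core
Planarity instance (with `E_1 = E_p`, `E_2 = E_s`, `W = E_t`) is positive. -/
theorem hpp_drawing_implies_fccp_positive {V : Type} (Ep Es Et : EdgeSet V)
    (hps : Disjoint Ep Es) (hpt : Disjoint Ep Et) (hst : Disjoint Es Et)
    (hsimple : ∀ e ∈ Ep ∪ Es ∪ Et, e.1 ≠ e.2)
    (D : Drawing V (Ep ∪ Es ∪ Et)) (hD : NoForbiddenCrossing Ep Es Et D) :
    (D.restrict (Ep ∪ Es) Set.subset_union_left).Planar ∧
    (∀ e ∈ Et, ∃ f,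
      (D.restrict (Ep ∪ Es) Set.subset_union_left).IsFaceOf Ep f ∧
      (D.restrict (Ep ∪ Es) Set.subset_union_left).VertexOn f e.1 ∧
      (D.restrict (Ep ∪ Es) Set.subset_union_left).VertexOn f e.2) ∧
    FCCPPositive V Ep Es Et := by
  have hplanar : (D.restrict (Ep ∪ Es) Set.subset_union_left).Planar := by
    intro e he e' he' hc
    refine hD e (Or.inl he) e' (Or.inl he') hc ?_
    rcases he with he | he
    · exact Or.inl he
    rcases he' with he' | he'
    · exact Or.inr (Or.inl he')
    · exact Or.inr (Or.inr ⟨he, he'⟩)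
  have hface : ∀ e ∈ Et, ∃ f,
      (D.restrict (Ep ∪ Es) Set.subset_union_left).IsFaceOf Ep f ∧
      (D.restrict (Ep ∪ Es) Set.subset_union_left).VertexOn f e.1 ∧
      (D.restrict (Ep ∪ Es) Set.subset_union_left).VertexOn f e.2 := fun e he =>
    D.exists_common_face (fun _ h => Or.inl (Or.inl h)) (Or.inr he)
      (fun h => Set.disjoint_left.1 hpt h he)
      (fun e' he' hc => hD e (Or.inr he) e' (Or.inl (Or.inl he')) hc (Or.inr (Or.inl he')))
  exact ⟨hplanar, hface, _, hplanar, hface⟩
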